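/- For $n \ge 2$, the reduced Lusternik–Schnirelmann category of $K_n$ equals $n$; that is, $K_n$ can be covered by $n+1$ open sets each contractible in $K_n$, but not by $n$ such open sets. -/

import Mathlib

noncomputable section

/-- Complex conjugation on the unit circle. -/
def Circle.conj (z : Circle) : Circle :=
  ⟨starRingEnd ℂ z, by
    have := z.2
    simp only [Submonoid.unitSphere, Submonoid.mem_mk, Subsemigroup.mem_mk] at *
    simp_all [mem_sphere_zero_iff_norm]⟩

/-- Negation on the unit circle. -/
def Circle.neg (z : Circle) : Circle :=
  ⟨-(z : ℂ), by
    have := z.2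
    simp only [Submonoid.unitSphere, Submonoid.mem_mk, Subsemigroup.mem_mk] at *
    simp_all [mem_sphere_zero_iff_norm]⟩

/-- The torus `(S¹)ⁿ`. -/
abbrev Torus (n : ℕ) : Type := Fin n → Circle

/-- The involution `(z₁,…,z_{n-1},z_n) ↦ (z̄₁,…,z̄_{n-1},-z_n)` on the torus. -/
def kleinInvolution (n : ℕ) (z : Torus n) : Torus n :=
  fun i => if (i : ℕ) + 1 = n then (z i).neg else (z i).conj

/-- The identification defining the `n`-dimensional Klein bottle. -/
def KleinRel (n : ℕ) (z w : Torus n) : Prop := w = kleinInvolution n z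

/-- The `n`-dimensional Klein bottle `Kₙ = (S¹)ⁿ/((z,z_n) ∼ (z̄,-z_n))`. -/
def Klein (n : ℕ) : Type := Quot (KleinRel n)

instance (n : ℕ) : TopologicalSpace (Klein n) := instTopologicalSpaceQuot

/-- A subset `U` of `X` is contractible in `X` if the inclusion `U ↪ X` is homotopic
to a constant map. -/
def ContractibleIn {X : Type} [TopologicalSpace X] (U : Set X) : Prop :=
  ∃ x₀ : X,
    ContinuousMap.Homotopic
      ⟨(Subtype.val : U → X), continuous_subtype_val⟩
      (ContinuousMap.const U x₀)

/-! ### Mod 2 cochains on a grid -/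

namespace GridCochain

variable {ι X : Type*} [AddCommMonoid X]

/-- The cocycle condition for a 1-cochain. -/
def IsCocycle (e : ι → X) (c : X → ι → ZMod 2) : Prop :=
  ∀ x a b, c x a + c (x + e a) b = c x b + c (x + e b) a

lemma IsCocycle.add_delta {e : ι → X} {c : X → ι → ZMod 2} (hc : IsCocycle e c)
    (u : X → ZMod 2) : IsCocycle e (c + fun x a => u (x + e a) + u x) := by
  intro x a b
  have h1 := hc x a b
  have h2 := CharTwo.add_self_eq_zero (u (x + e a))
  have h3 := CharTwo.add_self_eq_zero (u (x + e b))
  simp only [Pi.add_apply, add_right_comm x (e b) (e a)]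
  linear_combination h1 + h2 - h3

variable [DecidableEq ι]

/-- The cup product of a 1-cochain with a cochain on the grid with edge vectors `e`; a cochain
takes a base point and a set of directions. -/
def cup (e : ι → X) (c : X → ι → ZMod 2) (w : X → Finset ι → ZMod 2) :
    X → Finset ι → ZMod 2 :=
  fun x S => ∑ a ∈ S, c x a * w (x + e a) (S.erase a)

/-- The mod 2 cubical coboundary. -/
def coboundary (e : ι → X) (w : X → Finset ι → ZMod 2) : X → Finset ι → ZMod 2 :=
  fun x S => ∑ a ∈ S, (w (x + e a) (S.erase a) + w x (S.erase a))

/-- The unit 0-cochain. -/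
def unit : X → Finset ι → ZMod 2 := fun _ S => if S = ∅ then 1 else 0

/-- The iterated cup product of a list of 1-cochains. -/
def cupList (e : ι → X) (L : List (X → ι → ZMod 2)) : X → Finset ι → ZMod 2 :=
  L.foldr (cup e) unit

lemma sum_sum_erase_comm {M : Type*} [AddCommMonoid M] (S : Finset ι) (F : ι → ι → M) :
    ∑ a ∈ S, ∑ b ∈ S.erase a, F a b = ∑ a ∈ S, ∑ b ∈ S.erase a, F b a := by
  apply Finset.sum_comm'
  intro a b
  simp only [Finset.mem_erase]
  tauto

lemma sum_sum_erase_eq_zero (S : Finset ι) (F : ι → ι → ZMod 2) (hF : ∀ a b, F a b = F b a) :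
    ∑ a ∈ S, ∑ b ∈ S.erase a, F a b = 0 := by
  rw [← Finset.sum_finset_product' S.offDiag S (fun a => S.erase a)
    (by rintro ⟨a, b⟩; simp only [Finset.mem_offDiag, Finset.mem_erase]; tauto)]
  refine Finset.sum_involution (fun p _ => (p.2, p.1)) ?_ ?_ ?_ ?_
  · rintro ⟨a, b⟩ _
    simp only [hF b a]
    exact CharTwo.add_self_eq_zero _
  · rintro ⟨a, b⟩ h _ h'
    simp only [Finset.mem_offDiag, Prod.mk.injEq] at h h'
    exact h.2.2 h'.2
  · rintro ⟨a, b⟩ h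
    simp only [Finset.mem_offDiag] at h ⊢
    tauto
  · simp

lemma cup_coboundary (e : ι → X) {c : X → ι → ZMod 2} (hc : IsCocycle e c)
    (w : X → Finset ι → ZMod 2) : cup e c (coboundary e w) = coboundary e (cup e c w) := by
  funext x S
  have h1 : coboundary e (cup e c w) x S =
      ∑ a ∈ S, ∑ b ∈ S.erase a, c (x + e a) b * w (x + e a + e b) ((S.erase a).erase b) +
      ∑ a ∈ S, ∑ b ∈ S.erase a, c x a * w (x + e a) ((S.erase a).erase b) := by
    rw [sum_sum_erase_comm S fun a b => c x a * w (x + e a) ((S.erase a).erase b),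
      ← Finset.sum_add_distrib]
    simp only [coboundary, cup]
    refine Finset.sum_congr rfl fun a _ => ?_
    congr 1
    exact Finset.sum_congr rfl fun b _ => by rw [Finset.erase_right_comm]
  have h2 : cup e c (coboundary e w) x S =
      ∑ a ∈ S, ∑ b ∈ S.erase a, c x a * w (x + e a + e b) ((S.erase a).erase b) +
      ∑ a ∈ S, ∑ b ∈ S.erase a, c x a * w (x + e a) ((S.erase a).erase b) := by
    simp only [coboundary, cup, ← Finset.sum_add_distrib, Finset.mul_sum, mul_add]
  rw [h1, h2, add_left_inj, ← sub_eq_zero, CharTwo.sub_eq_add, ← Finset.sum_add_distrib]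
  simp only [← Finset.sum_add_distrib, ← add_mul]
  refine sum_sum_erase_eq_zero S _ fun a b => ?_
  rw [hc x a b, add_right_comm x (e a) (e b), Finset.erase_right_comm]

lemma cup_delta (e : ι → X) (u : X → ZMod 2) (w : X → Finset ι → ZMod 2) :
    cup e (fun x a => u (x + e a) + u x) w =
      fun x S => coboundary e (fun x S => u x * w x S) x S + u x * coboundary e w x S := by
  funext x S
  simp only [cup, coboundary, Finset.mul_sum, ← Finset.sum_add_distrib]
  refine Finset.sum_congr rfl fun a _ => ?_
  have := CharTwo.add_self_eq_zero (u x * w x (S.erase a))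
  linear_combination -this

lemma coboundary_cupList (e : ι → X) (L : List (X → ι → ZMod 2)) (hL : ∀ c ∈ L, IsCocycle e c) :
    coboundary e (cupList e L) = 0 := by
  induction L with
  | nil =>
    funext x S
    refine Finset.sum_eq_zero fun a _ => ?_
    exact CharTwo.add_self_eq_zero _
  | cons c L ih =>
    change coboundary e (cup e c (cupList e L)) = 0
    rw [← cup_coboundary e (hL c (by simp)), ih fun c h => hL c (by simp [h])]
    funext x S
    simp [cup]

lemma coboundary_add (e : ι → X) (w w' : X → Finset ι → ZMod 2) :
    coboundary e (w + w') = coboundary e w + coboundary e w' := by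
  funext x S
  simp only [coboundary, Pi.add_apply, ← Finset.sum_add_distrib]
  exact Finset.sum_congr rfl fun a _ => by ring

lemma cup_add (e : ι → X) (c : X → ι → ZMod 2) (w w' : X → Finset ι → ZMod 2) :
    cup e c (w + w') = cup e c w + cup e c w' := by
  funext x S
  simp only [cup, Pi.add_apply, ← Finset.sum_add_distrib, mul_add]

lemma add_cup (e : ι → X) (c c' : X → ι → ZMod 2) (w : X → Finset ι → ZMod 2) :
    cup e (c + c') w = cup e c w + cup e c' w := by
  funext x S
  simp only [cup, Pi.add_apply, ← Finset.sum_add_distrib, add_mul]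

/-- Cup products of cohomologous cocycles are cohomologous. -/
lemma exists_cupList_eq_add_coboundary {κ : Type*} (e : ι → X) (c : κ → X → ι → ZMod 2)
    (u : κ → X → ZMod 2) (hc : ∀ k, IsCocycle e (c k)) (l : List κ) :
    ∃ w, cupList e (l.map fun k => c k + fun x a => u k (x + e a) + u k x) =
      cupList e (l.map c) + coboundary e w := by
  induction l with
  | nil => exact ⟨0, by funext x S; simp [coboundary]⟩
  | cons k l ih =>
    obtain ⟨w, hw⟩ := ih
    refine ⟨cup e (c k + fun x a => u k (x + e a) + u k x) w +
      fun x S => u k x * cupList e (l.map c) x S, ?_⟩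
    change cup e _ (cupList e (l.map fun k => c k + fun x a => u k (x + e a) + u k x)) =
      cup e (c k) (cupList e (l.map c)) + _
    rw [hw, cup_add, cup_coboundary e ((hc k).add_delta (u k)), coboundary_add, add_cup,
      cup_delta, coboundary_cupList e (l.map c) (by simpa using fun k _ => hc k)]
    funext x S
    simp only [Pi.add_apply, Pi.zero_apply]
    ring

lemma sum_coboundary {X : Type*} [AddCommGroup X] [Fintype X] (e : ι → X)
    (w : X → Finset ι → ZMod 2) (S : Finset ι) : ∑ x, coboundary e w x S = 0 := by
  simp only [coboundary]
  rw [Finset.sum_comm]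
  refine Finset.sum_eq_zero fun a _ => ?_
  rw [Finset.sum_add_distrib,
    Fintype.sum_equiv (Equiv.addRight (e a)) (fun x => w (x + e a) (S.erase a))
      (fun x => w x (S.erase a)) fun _ => rfl]
  exact CharTwo.add_self_eq_zero _

end GridCochain

/-! ### The discrete torus -/

namespace GridCochain

variable {n N : ℕ}

/-- The cocycle on the discrete torus `(ℤ/N)ⁿ` counting crossings of the hyperplane between `-1`
and `0` in the `k`-th direction. -/
def wrap (k : Fin n) (x : Fin n → ZMod N) (a : Fin n) : ZMod 2 :=
  if a = k ∧ x k = -1 then 1 else 0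

lemma isCocycle_wrap (k : Fin n) :
    IsCocycle (fun a : Fin n => (Pi.single a 1 : Fin n → ZMod N)) (wrap k) := by
  intro x a b
  by_cases ha : a = k <;> by_cases hb : b = k
  · rw [ha, hb]
  · simp [wrap, ha, hb, Ne.symm hb]
  · simp [wrap, ha, hb, Ne.symm ha]
  · simp [wrap, ha, hb]

lemma cupList_wrap (l : List (Fin n)) (hl : l.Nodup) (x : Fin n → ZMod N) (S : Finset (Fin n)) :
    cupList (fun a : Fin n => (Pi.single a 1 : Fin n → ZMod N)) (l.map wrap) x S =
      if S = l.toFinset ∧ ∀ k ∈ l, x k = -1 then 1 else 0 := by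
  induction l generalizing x S with
  | nil => simp [cupList, unit]
  | cons k l ih =>
    rw [List.nodup_cons] at hl
    change ∑ a ∈ S, wrap k x a * cupList _ (l.map wrap) _ _ = _
    have key : ∀ a ∈ S, wrap k x a *
        cupList (fun a : Fin n => (Pi.single a 1 : Fin n → ZMod N)) (l.map wrap)
          (x + Pi.single a 1) (S.erase a) =
        if a = k then (if S.erase k = l.toFinset ∧ ∀ j ∈ k :: l, x j = -1 then 1 else 0)
          else 0 := by
      intro a _
      rw [ih hl.2]
      by_cases ha : a = k
      · subst ha
        have : (∀ j ∈ l, (x + Pi.single a 1 : Fin n → ZMod N) j = -1) ↔ ∀ j ∈ l, x j = -1 := by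
          refine forall₂_congr fun j hj => ?_
          have : j ≠ a := fun h => hl.1 (h ▸ hj)
          simp [this]
        simp only [wrap, this, List.forall_mem_cons]
        by_cases h1 : x a = -1 <;> simp [h1]
      · simp [wrap, ha]
    rw [Finset.sum_congr rfl key, Finset.sum_ite_eq']
    by_cases hk : k ∈ S
    · have : S.erase k = l.toFinset ↔ S = (k :: l).toFinset := by
        rw [List.toFinset_cons]
        constructor
        · intro h; rw [← h, Finset.insert_erase hk]
        · intro h; rw [h, Finset.erase_insert (by simpa using hl.1)]
      simp only [hk, this, if_true]
    · rw [if_neg hk, if_neg]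
      rintro ⟨h, -⟩
      exact hk (by simp [h])

lemma cupList_eq_zero {c : Fin n → (Fin n → ZMod N) → Fin n → ZMod 2} {k : Fin n}
    (x : Fin n → ZMod N)
    (hk : ∀ (y : Fin n → ZMod N) a, (∀ i, y i = x i ∨ y i = x i + 1) → y a = x a → c k y a = 0)
    (l : List (Fin n)) (hkl : k ∈ l) (y : Fin n → ZMod N) (S : Finset (Fin n))
    (hy : ∀ i, y i = x i ∨ y i = x i + 1) (hS : ∀ i ∈ S, y i = x i) :
    cupList (fun a : Fin n => (Pi.single a 1 : Fin n → ZMod N)) (l.map c) y S = 0 := by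
  induction l generalizing y S with
  | nil => simp at hkl
  | cons j l ih =>
    refine Finset.sum_eq_zero fun a ha => ?_
    rcases List.mem_cons.1 hkl with rfl | hkl
    · rw [hk y a hy (hS a ha), zero_mul]
    · refine mul_eq_zero_of_right _ (ih hkl _ _ (fun i => ?_) fun i hi => ?_)
      · by_cases hi : i = a
        · subst hi
          simp [hS i ha]
        · simpa [Pi.single_apply, hi] using hy i
      · rw [Finset.mem_erase] at hi
        simpa [Pi.single_apply, hi.1] using hS i hi.2

/-- If cocycles cohomologous to the `wrap k` are given on the discrete torus, then on some unit
cube none of them vanishes. -/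
theorem exists_cube [NeZero N] (u : Fin n → (Fin n → ZMod N) → ZMod 2) :
    ∃ x : Fin n → ZMod N, ∀ k, ∃ (y : Fin n → ZMod N) (a : Fin n),
      (∀ i, y i = x i ∨ y i = x i + 1) ∧ y a = x a ∧
      wrap k y a + (u k (y + Pi.single a 1) + u k y) ≠ 0 := by
  by_contra! hcon
  let e : Fin n → (Fin n → ZMod N) := fun a => Pi.single a 1
  obtain ⟨w, hw⟩ := exists_cupList_eq_add_coboundary e wrap u isCocycle_wrap (List.finRange n)
  have h0 : ∀ x, cupList e ((List.finRange n).map fun k =>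
      wrap k + fun x a => u k (x + e a) + u k x) x Finset.univ = 0 := by
    intro x
    obtain ⟨k, hk⟩ := hcon x
    exact cupList_eq_zero (k := k) x (fun y a hy ha => hk y a hy ha) _ (List.mem_finRange k) x _
      (fun _ => Or.inl rfl) fun _ _ => rfl
  have h1 : ∑ x, cupList e ((List.finRange n).map wrap) x Finset.univ = 1 := by
    have : ∀ x : Fin n → ZMod N, cupList e ((List.finRange n).map wrap) x Finset.univ =
        if x = fun _ => -1 then 1 else 0 := by
      intro x
      rw [cupList_wrap _ (List.nodup_finRange n)]
      congr 1
      simp [funext_iff]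
    simp only [this, Finset.sum_ite_eq', Finset.mem_univ, if_true]
  have h2 := sum_coboundary e w Finset.univ
  simp only [hw, Pi.add_apply] at h0
  have h3 : ∑ x, (cupList e ((List.finRange n).map wrap) x Finset.univ +
      coboundary e w x Finset.univ) = 0 := Finset.sum_eq_zero fun x _ => h0 x
  rw [Finset.sum_add_distrib, h1, h2, add_zero] at h3
  exact one_ne_zero h3

end GridCochain

/-! ### Covers of the torus -/

lemma Circle.dist_exp_le (x y : ℝ) : dist (Circle.exp x) (Circle.exp y) ≤ |x - y| := by
  have h : dist (Circle.exp x) (Circle.exp y) =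
      ‖Complex.exp (x * Complex.I) - Complex.exp (y * Complex.I)‖ := by
    rw [← Circle.coe_exp, ← Circle.coe_exp, ← dist_eq_norm]; rfl
  have h2 : Complex.exp (x * Complex.I) - Complex.exp (y * Complex.I) =
      Complex.exp (y * Complex.I) * (Complex.exp (Complex.I * ((x - y : ℝ) : ℂ)) - 1) := by
    rw [mul_sub, ← Complex.exp_add, mul_one]
    congr 2
    push_cast
    ring
  rw [h, h2, norm_mul, Complex.norm_exp_ofReal_mul_I, one_mul]
  exact Real.norm_exp_I_mul_ofReal_sub_one_le

/-- If `exp (2πφ) = 1` along an interval then `φ` is constant there. -/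
lemma eq_of_circle_exp_eq_one {φ : ℝ → ℝ} (hφ : ContinuousOn φ (Set.Icc 0 1))
    (h : ∀ t ∈ Set.Icc (0 : ℝ) 1, Circle.exp (2 * Real.pi * φ t) = 1) :
    ∃ m : ℤ, φ 0 = m ∧ φ 1 = m := by
  have hint : ∀ t ∈ Set.Icc (0 : ℝ) 1, ∃ m : ℤ, φ t = m := by
    intro t ht
    obtain ⟨m, hm⟩ := Circle.exp_eq_one.1 (h t ht)
    refine ⟨m, ?_⟩
    have := Real.pi_pos
    have h2 : 2 * Real.pi * (φ t - m) = 0 := by linear_combination hm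
    rcases mul_eq_zero.1 h2 with h3 | h3
    · linarith
    · linarith
  obtain ⟨m, hm⟩ := hint 0 (by simp)
  refine ⟨m, hm, ?_⟩
  have hpre : IsPreconnected (φ '' Set.Icc 0 1) := isPreconnected_Icc.image _ hφ
  have hsub : (φ '' Set.Icc 0 1) ⊆ Set.range ((↑) : ℤ → ℝ) := by
    rintro _ ⟨t, ht, rfl⟩
    obtain ⟨m, hm⟩ := hint t ht
    exact ⟨m, hm.symm⟩
  have hss : (φ '' Set.Icc 0 1).Subsingleton :=
    ((Set.countable_range _).mono hsub).isTotallyDisconnected _ subset_rfl hpre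
  rw [← hm]
  exact hss ⟨1, by simp, rfl⟩ ⟨0, by simp, rfl⟩

namespace GridCochain

variable {n N : ℕ}

/-- The position of a residue mod `N` on the unit interval. -/
def position (y : ZMod N) : ℝ := (y.val : ℝ) / N

lemma position_add_one [NeZero N] (y : ZMod N) :
    position (y + 1) = position y + 1 / N - if y = -1 then 1 else 0 := by
  have hN : (N : ℝ) ≠ 0 := Nat.cast_ne_zero.2 (NeZero.ne N)
  have key : ((y + 1).val : ℝ) = y.val + 1 - if y = -1 then (N : ℝ) else 0 := by
    obtain ⟨M, rfl⟩ : ∃ M, N = M + 1 := ⟨N - 1, (Nat.succ_pred (NeZero.ne N)).symm⟩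
    split_ifs with h
    · subst h
      simp [ZMod.val_neg_one]
    · have h1 : y.val < M + 1 := ZMod.val_lt y
      have h2 : y.val ≠ M := fun h' => h <| ZMod.val_injective _ <| by
        rw [h', ZMod.val_neg_one]
      have : Fact (1 < M + 1) := ⟨by omega⟩
      rw [ZMod.val_add_of_lt] <;> rw [ZMod.val_one]
      · simp
      · omega
  simp only [position, key]
  split_ifs
  · field_simp
  · simp [add_div]

end GridCochain

open GridCochain in
/-- The torus `(S¹)ⁿ` has no cover by `n` open sets such that the `k`-th coordinate has a
continuous logarithm on the `k`-th set. -/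
theorem Torus.no_log_cover (n : ℕ) (V : Fin n → Set (Torus n)) (hV : ∀ k, IsOpen (V k))
    (hcov : ⋃ k, V k = Set.univ) (f : Fin n → Torus n → ℝ)
    (hf : ∀ k, ContinuousOn (f k) (V k))
    (hexp : ∀ k, ∀ z ∈ V k, Circle.exp (f k z) = z k) : False := by
  have hpi := Real.pi_pos
  obtain ⟨δ, hδ, hleb⟩ := lebesgue_number_lemma_of_metric (isCompact_univ (X := Torus n)) hV
    hcov.ge
  obtain ⟨M, hM⟩ := exists_nat_gt (2 * Real.pi / δ)
  obtain ⟨N, hN1, hN⟩ : ∃ N : ℕ, 0 < N ∧ 2 * Real.pi / N < δ := by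
    have hMpos : (0 : ℝ) < M := lt_trans (by positivity) hM
    exact ⟨M, by exact_mod_cast hMpos, by rwa [div_lt_comm₀ hMpos hδ]⟩
  have : NeZero N := ⟨hN1.ne'⟩
  have hNR : (0 : ℝ) < N := by exact_mod_cast hN1
  let pt : (Fin n → ZMod N) → Torus n := fun y i => Circle.exp (2 * Real.pi * position (y i))
  obtain ⟨x, hx⟩ := exists_cube fun k (y : Fin n → ZMod N) =>
    ((round (f k (pt y) / (2 * Real.pi) - position (y k)) : ℤ) : ZMod 2)
  obtain ⟨k, hk⟩ := hleb (pt x) trivial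
  obtain ⟨y, a, hy, hya, hne⟩ := hx k
  let γ : ℝ → Torus n := fun t i =>
    Circle.exp (2 * Real.pi * (position (y i) + t * (Pi.single a 1 : Fin n → ℝ) i / N))
  have hγc : Continuous γ := by
    refine continuous_pi fun i => Circle.exp.continuous.comp ?_
    fun_prop
  have hγV : ∀ t ∈ Set.Icc (0 : ℝ) 1, γ t ∈ V k := by
    intro t ht
    apply hk
    rw [Metric.mem_ball, dist_pi_lt_iff hδ]
    intro i
    obtain ⟨s, hs, hsi⟩ : ∃ s ∈ Set.Icc (0 : ℝ) 1, γ t i =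
        Circle.exp (2 * Real.pi * (position (x i) + s / N)) := by
      by_cases hi : i = a
      · subst hi
        exact ⟨t, ht, by simp [γ, hya]⟩
      · rcases hy i with h | h
        · exact ⟨0, by simp, by simp [γ, hi, h]⟩
        · refine ⟨1, by simp, ?_⟩
          simp only [γ, h, Pi.single_eq_of_ne hi, mul_zero, zero_div, add_zero, position_add_one]
          split_ifs
          · rw [mul_sub, Circle.exp_sub, mul_one]
            simp
          · simp
    rw [hsi]
    refine (Circle.dist_exp_le _ _).trans_lt ?_
    rw [← mul_sub, add_sub_cancel_left, abs_of_nonneg (by have := hs.1; positivity)]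
    refine lt_of_le_of_lt ?_ hN
    rw [← mul_div_assoc]
    exact div_le_div_of_nonneg_right (mul_le_of_le_one_right (by positivity) hs.2) hNR.le
  let φ : ℝ → ℝ := fun t =>
    f k (γ t) / (2 * Real.pi) - (position (y k) + t * (Pi.single a 1 : Fin n → ℝ) k / N)
  have hφc : ContinuousOn φ (Set.Icc 0 1) := by
    have : ContinuousOn (fun t => f k (γ t)) (Set.Icc 0 1) := (hf k).comp hγc.continuousOn hγV
    exact (this.div_const _).sub (by fun_prop)
  obtain ⟨m, hm0, hm1⟩ := eq_of_circle_exp_eq_one hφc fun t ht => by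
    have : 2 * Real.pi * φ t = f k (γ t) -
        2 * Real.pi * (position (y k) + t * (Pi.single a 1 : Fin n → ℝ) k / N) := by
      simp only [φ]
      field_simp
    rw [this, Circle.exp_sub, hexp k _ (hγV t ht), div_eq_one]
  have hγ0 : γ 0 = pt y := by simp [γ, pt]
  have hpos : ∀ i, position ((y + Pi.single a 1 : Fin n → ZMod N) i) = position (y i) +
      (Pi.single a 1 : Fin n → ℝ) i / N - if a = i ∧ y i = -1 then 1 else 0 := by
    intro i
    by_cases hi : i = a
    · subst hi
      simp [position_add_one]
    · simp [hi, Ne.symm hi]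
  have hγ1 : γ 1 = pt (y + Pi.single a 1) := by
    funext i
    simp only [γ, pt, hpos, one_mul]
    split_ifs
    · rw [mul_sub, Circle.exp_sub, mul_one]
      simp
    · simp
  have e0 : round (f k (pt y) / (2 * Real.pi) - position (y k)) = m := by
    rw [← hγ0]
    simp only [φ, zero_mul, zero_div, add_zero] at hm0
    rw [hm0, round_intCast]
  have e1 : round (f k (pt (y + Pi.single a 1)) / (2 * Real.pi) -
      position ((y + Pi.single a 1 : Fin n → ZMod N) k)) =
      m + if a = k ∧ y k = -1 then 1 else 0 := by
    rw [← hγ1, hpos, ← round_intCast (α := ℝ) (m + if a = k ∧ y k = -1 then 1 else 0)]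
    congr 1
    simp only [φ, one_mul] at hm1
    push_cast
    rw [← hm1]
    ring
  apply hne
  rw [e0, e1, wrap]
  push_cast
  have h1 := CharTwo.add_self_eq_zero (m : ZMod 2)
  have h2 := CharTwo.add_self_eq_zero (if a = k ∧ y k = -1 then (1 : ZMod 2) else 0)
  linear_combination h1 + h2

/-! ### The covering `(S¹)ⁿ → Kₙ` -/

lemma Circle.conj_eq_inv (z : Circle) : z.conj = z⁻¹ :=
  Circle.ext (Circle.coe_inv_eq_conj z).symm

lemma Circle.neg_eq_neg (z : Circle) : z.neg = -z := rfl

section Involution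

variable {n : ℕ}

lemma kleinInvolution_apply (z : Torus n) (i : Fin n) :
    kleinInvolution n z i = if (i : ℕ) + 1 = n then -z i else (z i)⁻¹ := by
  rw [kleinInvolution, Circle.conj_eq_inv, Circle.neg_eq_neg]

lemma kleinInvolution_kleinInvolution (z : Torus n) :
    kleinInvolution n (kleinInvolution n z) = z := by
  funext i
  rw [kleinInvolution_apply, kleinInvolution_apply]
  split_ifs <;> simp

lemma continuous_kleinInvolution : Continuous (kleinInvolution n) := by
  refine continuous_pi fun i => ?_
  simp only [kleinInvolution_apply]
  split_ifs <;> fun_prop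

lemma kleinInvolution_ne (hn : 0 < n) (z : Torus n) : kleinInvolution n z ≠ z := by
  intro h
  have := congrFun h ⟨n - 1, by omega⟩
  rw [kleinInvolution_apply, if_pos (by simp; omega)] at this
  exact Circle.neg_ne_self _ this

/-- The quotient map from the torus to the Klein bottle. -/
def Klein.mk (z : Torus n) : Klein n := Quot.mk _ z

lemma Klein.isQuotientMap_mk : Topology.IsQuotientMap (Klein.mk (n := n)) := isQuotientMap_quot_mk

lemma Klein.mk_kleinInvolution (z : Torus n) :
    Klein.mk (kleinInvolution n z) = Klein.mk z := (Quot.sound (r := KleinRel n) rfl).symm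

lemma Klein.mk_eq_mk_iff {z w : Torus n} :
    Klein.mk z = Klein.mk w ↔ z = w ∨ z = kleinInvolution n w := by
  refine ⟨fun h => ?_, ?_⟩
  · have h' := Quot.eqvGen_exact h
    induction h' with
    | rel a b hab => right; rw [hab, kleinInvolution_kleinInvolution]
    | refl a => left; rfl
    | symm a b hab ih =>
      rcases ih (Quot.eqvGen_sound hab) with rfl | rfl
      · left; rfl
      · right; rw [kleinInvolution_kleinInvolution]
    | trans a b c hab hbc ih1 ih2 =>
      rcases ih1 (Quot.eqvGen_sound hab) with rfl | rfl <;>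
        rcases ih2 (Quot.eqvGen_sound hbc) with rfl | rfl <;>
        simp [kleinInvolution_kleinInvolution]
  · rintro (rfl | rfl)
    · rfl
    · exact Klein.mk_kleinInvolution w

/-- The action of the group of order two on the torus by the involution. -/
abbrev kleinAction (n : ℕ) : MulAction (Multiplicative (ZMod 2)) (Torus n) where
  smul g z := if g = 1 then z else kleinInvolution n z
  one_smul z := if_pos rfl
  mul_smul g h z := by
    change (if g * h = 1 then z else kleinInvolution n z) =
      if g = 1 then (if h = 1 then z else kleinInvolution n z)
        else kleinInvolution n (if h = 1 then z else kleinInvolution n z)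
    have key : ∀ g : Multiplicative (ZMod 2), g = 1 ∨ g = Multiplicative.ofAdd 1 := by decide
    have h1 : (Multiplicative.ofAdd (1 : ZMod 2)) ≠ 1 := by decide
    have h2 : (Multiplicative.ofAdd (1 : ZMod 2)) * Multiplicative.ofAdd 1 = 1 := by decide
    rcases key g with rfl | rfl <;> rcases key h with rfl | rfl <;>
      simp only [mul_one, one_mul, if_true, h1, h2, if_false, kleinInvolution_kleinInvolution]

lemma Klein.isQuotientCoveringMap_mk (hn : 0 < n) :
    letI := kleinAction n
    IsQuotientCoveringMap (Klein.mk (n := n)) (Multiplicative (ZMod 2)) := by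
  let := kleinAction n
  have smul_def : ∀ (g : Multiplicative (ZMod 2)) (z : Torus n),
      g • z = if g = 1 then z else kleinInvolution n z := fun _ _ => rfl
  refine { Klein.isQuotientMap_mk with
    continuous_const_smul := ?_, apply_eq_iff_mem_orbit := ?_, disjoint := ?_ }
  · intro g
    simp only [smul_def]
    split_ifs
    · exact continuous_id
    · exact continuous_kleinInvolution
  · intro z w
    rw [Klein.mk_eq_mk_iff, MulAction.mem_orbit_iff]
    constructor
    · rintro (rfl | rfl)
      · exact ⟨1, one_smul _ _⟩
      · exact ⟨Multiplicative.ofAdd 1, if_neg (by decide)⟩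
    · rintro ⟨g, rfl⟩
      rw [smul_def]
      split_ifs <;> simp
  · intro z
    obtain ⟨A, B, hA, hB, hzA, hzB, hAB⟩ := t2_separation (kleinInvolution_ne hn z).symm
    refine ⟨A ∩ kleinInvolution n ⁻¹' B, (hA.inter (hB.preimage continuous_kleinInvolution)).mem_nhds
      ⟨hzA, hzB⟩, fun g hg => ?_⟩
    by_contra hg1
    obtain ⟨_, ⟨w, hw, rfl⟩, hw'⟩ := hg
    simp only [smul_def, if_neg hg1] at hw'
    exact Set.disjoint_left.1 hAB hw'.1 hw.2

lemma Klein.isCoveringMap_mk (hn : 0 < n) : IsCoveringMap (Klein.mk (n := n)) :=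
  letI := kleinAction n
  (Klein.isQuotientCoveringMap_mk hn).isCoveringMap

lemma Klein.isOpenQuotientMap_mk (hn : 0 < n) : IsOpenQuotientMap (Klein.mk (n := n)) :=
  letI := kleinAction n
  (Klein.isQuotientCoveringMap_mk hn).isOpenQuotientMap

end Involution

/-! ### The lower bound -/

/-- Over a set contractible in `Kₙ`, every coordinate of the torus has a continuous logarithm. -/
theorem ContractibleIn.exists_log {n : ℕ} {U : Set (Klein n)} (hU : ContractibleIn U)
    (k : Fin n) : ∃ f : Torus n → ℝ, ContinuousOn f (Klein.mk ⁻¹' U) ∧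
      ∀ z ∈ Klein.mk ⁻¹' U, Circle.exp (f z) = z k := by
  have hn : 0 < n := k.pos
  obtain ⟨x₀, ⟨F⟩⟩ := hU
  obtain ⟨p₀, rfl⟩ := Klein.isQuotientMap_mk.surjective x₀
  let q : C(Klein.mk ⁻¹' U, U) := ⟨fun v => ⟨Klein.mk v.1, v.2⟩,
    (Klein.isQuotientMap_mk.continuous.comp continuous_subtype_val).subtype_mk _⟩
  let H : C(unitInterval × (Klein.mk ⁻¹' U : Set (Torus n)), Klein n) :=
    F.symm.toContinuousMap.comp ((ContinuousMap.id _).prodMap q)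
  have H0 : ∀ v, H (0, v) = Klein.mk (ContinuousMap.const _ p₀ v) := fun v =>
    F.symm.apply_zero (q v)
  have H1 : ∀ v, H (1, v) = Klein.mk v.1 := fun v => F.symm.apply_one (q v)
  let G := (Klein.isCoveringMap_mk hn).liftHomotopy H _ H0
  have hG : ∀ v, Klein.mk (G (1, v)) = Klein.mk v.1 := fun v => by
    rw [← H1]
    exact congrFun ((Klein.isCoveringMap_mk hn).liftHomotopy_lifts H _ H0) (1, v)
  have hG0 : ∀ v, G (0, v) = p₀ := (Klein.isCoveringMap_mk hn).liftHomotopy_zero H _ H0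
  let Gk : C(unitInterval × (Klein.mk ⁻¹' U : Set (Torus n)), Circle) :=
    ⟨fun x => G x k, (continuous_apply k).comp G.continuous⟩
  obtain ⟨s, hs⟩ := Circle.exp_surjective (p₀ k)
  have Gk0 : ∀ v, Gk (0, v) = Circle.exp (ContinuousMap.const _ s v) := fun v => by
    change G (0, v) k = Circle.exp s
    rw [hG0, hs]
  let g := Circle.isCoveringMap_exp.liftHomotopy Gk _ Gk0
  have hg : ∀ v, Circle.exp (g (1, v)) = G (1, v) k := fun v =>
    congrFun (Circle.isCoveringMap_exp.liftHomotopy_lifts Gk _ Gk0) (1, v)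
  have hGv : ∀ v, G (1, v) = v.1 ∨ G (1, v) = kleinInvolution n v.1 := fun v =>
    Klein.mk_eq_mk_iff.1 (hG v)
  have hG1 : Continuous fun v => G (1, v) := by fun_prop
  have hg1 : Continuous fun v => g (1, v) := by fun_prop
  let A : Set (Klein.mk ⁻¹' U : Set (Torus n)) := {v | G (1, v) = v.1}
  have hA : IsClopen A := by
    refine ⟨isClosed_eq hG1 continuous_subtype_val, ?_⟩
    have : Aᶜ = {v | G (1, v) = kleinInvolution n v.1} := by
      ext v
      rcases hGv v with h | h
      · simp only [A, Set.mem_compl_iff, Set.mem_ofPred_eq, h, not_true_eq_false, false_iff]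
        exact (kleinInvolution_ne hn _).symm
      · simp only [A, Set.mem_compl_iff, Set.mem_ofPred_eq, h, iff_true]
        exact kleinInvolution_ne hn _
    rw [← isClosed_compl_iff, this]
    exact isClosed_eq hG1 (continuous_kleinInvolution.comp continuous_subtype_val)
  classical
  let f' : (Klein.mk ⁻¹' U : Set (Torus n)) → ℝ := A.piecewise (fun v => g (1, v)) fun v =>
    if (k : ℕ) + 1 = n then g (1, v) + Real.pi else -g (1, v)
  have hf' : Continuous f' := by
    refine continuous_piecewise (by simp [hA.frontier_eq]) hg1.continuousOn ?_
    split_ifs <;> fun_prop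
  have hf'e : ∀ v, Circle.exp (f' v) = v.1 k := by
    intro v
    by_cases hv : v ∈ A
    · simp only [f', Set.piecewise_eq_of_mem _ _ _ hv, hg]
      rw [show G (1, v) = v.1 from hv]
    · simp only [f', Set.piecewise_eq_of_notMem _ _ _ hv]
      have h := congrFun ((hGv v).resolve_left hv) k
      rw [kleinInvolution_apply] at h
      split_ifs at h ⊢
      · rw [Circle.exp_add, hg, h, show Circle.exp Real.pi = -1 from Circle.ext (by simp [Circle.coe_exp])]
        simp
      · rw [Circle.exp_neg, hg, h, inv_inv]
  refine ⟨fun z => if h : z ∈ Klein.mk ⁻¹' U then f' ⟨z, h⟩ else 0, ?_, fun z hz => ?_⟩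
  · rw [continuousOn_iff_continuous_domRestrict]
    refine hf'.congr fun v => ?_
    simp only [Set.domRestrict_apply]
    rw [dif_pos v.2]
  · simp only [dif_pos hz]
    exact hf'e ⟨z, hz⟩

/-! ### The upper bound -/

/-- A set that deforms in a path connected space through a homotopy with locally constant end
is contractible in it. -/
lemma ContractibleIn.of_locallyConstant {X : Type} [TopologicalSpace X] [PathConnectedSpace X]
    {U : Set X} (H : unitInterval × U → X) (hH : Continuous H) (H0 : ∀ u, H (0, u) = u.1)
    (H1 : IsLocallyConstant fun u => H (1, u)) : ContractibleIn U := by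
  obtain ⟨x₀⟩ := (inferInstance : Nonempty X)
  refine ⟨x₀, ?_⟩
  let e : C(U, X) := ⟨fun u => H (1, u), H1.continuous⟩
  have h1 : ContinuousMap.Homotopic ⟨(Subtype.val : U → X), continuous_subtype_val⟩ e :=
    ⟨{ toFun := H
       continuous_toFun := hH
       map_zero_left := H0
       map_one_left := fun _ => rfl }⟩
  refine h1.trans ⟨{
    toFun := fun p => PathConnectedSpace.somePath (e p.2) x₀ p.1
    continuous_toFun := ?_
    map_zero_left := fun u => by simp
    map_one_left := fun u => by simp }⟩
  rw [continuous_iff_continuousAt]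
  rintro ⟨t, u⟩
  have hc : Continuous fun p : unitInterval × U =>
      PathConnectedSpace.somePath (e u) x₀ p.1 := by fun_prop
  refine hc.continuousAt.congr ?_
  have := (continuous_snd (X := unitInterval) (Y := U)).continuousAt (x := (t, u)) |>.eventually
    (H1.eventually_eq u)
  filter_upwards [this] with p hp
  have hp' : e p.2 = e u := hp
  have key : ∀ y y', y = y' → ∀ s : unitInterval,
      PathConnectedSpace.somePath y x₀ s = PathConnectedSpace.somePath y' x₀ s := by
    rintro y _ rfl s
    rfl
  exact key _ _ hp'.symm _

lemma IsLocallyConstant.of_continuous_of_finite_range {X Y : Type*} [TopologicalSpace X]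
    [TopologicalSpace Y] [T1Space Y] {f : X → Y} (hf : Continuous f) {D : Set Y} (hD : D.Finite)
    (h : ∀ x, f x ∈ D) : IsLocallyConstant f := by
  intro s
  rw [← isClosed_compl_iff]
  have : (f ⁻¹' s)ᶜ = f ⁻¹' (D \ s) := by
    ext x
    simp [h x]
  rw [this]
  exact (hD.subset Set.sdiff_subset).isClosed.preimage hf

namespace Circle

/-- Rescale the real and imaginary parts of a point of the circle by `s` and `t`, and project
back to the circle. -/
def scale (s t : ℝ) (z : Circle) : Circle :=
  if h : (⟨s * (z : ℂ).re, t * (z : ℂ).im⟩ : ℂ) = 0 then 1 else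
    ⟨⟨s * (z : ℂ).re, t * (z : ℂ).im⟩ / ‖(⟨s * (z : ℂ).re, t * (z : ℂ).im⟩ : ℂ)‖, by
      show _ ∈ Metric.sphere (0 : ℂ) 1
      rw [mem_sphere_zero_iff_norm, norm_div, Complex.norm_real, norm_norm,
        div_self (norm_ne_zero_iff.2 h)]⟩

lemma scale_eq_one {s t : ℝ} {z : Circle} (h : (⟨s * (z : ℂ).re, t * (z : ℂ).im⟩ : ℂ) = 0) :
    scale s t z = 1 :=
  dif_pos h

lemma coe_scale {s t : ℝ} {z : Circle} (h : (⟨s * (z : ℂ).re, t * (z : ℂ).im⟩ : ℂ) ≠ 0) :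
    (scale s t z : ℂ) = ⟨s * (z : ℂ).re, t * (z : ℂ).im⟩ /
      ‖(⟨s * (z : ℂ).re, t * (z : ℂ).im⟩ : ℂ)‖ :=
  congrArg (fun w : Circle => (w : ℂ)) (dif_neg h)

lemma scale_one_one (z : Circle) : scale 1 1 z = z := by
  have h : (⟨1 * (z : ℂ).re, 1 * (z : ℂ).im⟩ : ℂ) = z := by simp
  refine Circle.ext ?_
  rw [coe_scale (by rw [h]; exact z.coe_ne_zero), h, Circle.norm_coe]
  simp

lemma scale_inv (s t : ℝ) (z : Circle) : scale s t z⁻¹ = (scale s t z)⁻¹ := by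
  have h : (⟨s * ((z⁻¹ : Circle) : ℂ).re, t * ((z⁻¹ : Circle) : ℂ).im⟩ : ℂ) =
      starRingEnd ℂ ⟨s * (z : ℂ).re, t * (z : ℂ).im⟩ := by
    rw [Circle.coe_inv_eq_conj]
    apply Complex.ext <;> simp
  by_cases h0 : (⟨s * (z : ℂ).re, t * (z : ℂ).im⟩ : ℂ) = 0
  · have h0' := h
    rw [h0, map_zero] at h0'
    rw [scale_eq_one h0', scale_eq_one h0, inv_one]
  · refine Circle.ext ?_
    rw [Circle.coe_inv_eq_conj, coe_scale h0, coe_scale (by rw [h]; simpa using h0), h]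
    simp

lemma scale_neg {s t : ℝ} {z : Circle} (h0 : (⟨s * (z : ℂ).re, t * (z : ℂ).im⟩ : ℂ) ≠ 0) :
    scale s t (-z) = -scale s t z := by
  have h : (⟨s * ((-z : Circle) : ℂ).re, t * ((-z : Circle) : ℂ).im⟩ : ℂ) =
      -⟨s * (z : ℂ).re, t * (z : ℂ).im⟩ := by
    rw [Circle.coe_neg]
    apply Complex.ext <;> simp
  refine Circle.ext ?_
  rw [Circle.coe_neg, coe_scale h0, coe_scale (by rw [h]; simpa using h0), h, norm_neg, neg_div]

lemma continuousAt_scale {X : Type*} [TopologicalSpace X] {s t : X → ℝ} {z : X → Circle}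
    (hs : Continuous s) (ht : Continuous t) (hz : Continuous z) {x : X}
    (h : (⟨s x * (z x : ℂ).re, t x * (z x : ℂ).im⟩ : ℂ) ≠ 0) :
    ContinuousAt (fun x => scale (s x) (t x) (z x)) x := by
  have hzc : Continuous fun x => (z x : ℂ) := continuous_subtype_val.comp hz
  have hw : Continuous fun x => (⟨s x * (z x : ℂ).re, t x * (z x : ℂ).im⟩ : ℂ) := by
    have : Continuous fun x =>
        ((s x * (z x : ℂ).re : ℝ) : ℂ) + ((t x * (z x : ℂ).im : ℝ) : ℂ) * Complex.I := by
      fun_prop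
    refine this.congr fun x => ?_
    rw [Complex.mk_eq_add_mul_I]
  have hq : ContinuousAt (fun x => (⟨s x * (z x : ℂ).re, t x * (z x : ℂ).im⟩ : ℂ) /
      ‖(⟨s x * (z x : ℂ).re, t x * (z x : ℂ).im⟩ : ℂ)‖) x :=
    hw.continuousAt.div (Complex.continuous_ofReal.comp hw.norm).continuousAt (by simpa using h)
  have hi : Topology.IsInducing ((↑) : Circle → ℂ) := Topology.IsInducing.subtypeVal
  refine hi.continuousAt_iff.2 (hq.congr ?_)
  filter_upwards [hw.continuousAt.eventually_ne h] with y hy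
  exact (coe_scale hy).symm

/-- The fourth roots of unity. -/
def axisPoints : Set Circle := {z | (z : ℂ) ∈ ({1, -1, Complex.I, -Complex.I} : Set ℂ)}

lemma finite_axisPoints : axisPoints.Finite :=
  Set.Finite.preimage Circle.coe_injective.injOn (by simp)

lemma scale_one_zero_mem (z : Circle) : scale 1 0 z ∈ axisPoints := by
  by_cases h : (⟨1 * (z : ℂ).re, 0 * (z : ℂ).im⟩ : ℂ) = 0
  · rw [scale_eq_one h]
    simp [axisPoints]
  · have hr : (⟨1 * (z : ℂ).re, 0 * (z : ℂ).im⟩ : ℂ) = ((z : ℂ).re : ℂ) := by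
      apply Complex.ext <;> simp
    have h0 : ((z : ℂ).re : ℂ) ≠ 0 := hr ▸ h
    rw [axisPoints, Set.mem_ofPred_eq, coe_scale h, hr, Complex.norm_real, Real.norm_eq_abs]
    rcases abs_choice (z : ℂ).re with h1 | h1 <;> simp [h1, div_neg, div_self h0]

lemma scale_zero_one_mem (z : Circle) : scale 0 1 z ∈ axisPoints := by
  by_cases h : (⟨0 * (z : ℂ).re, 1 * (z : ℂ).im⟩ : ℂ) = 0
  · rw [scale_eq_one h]
    simp [axisPoints]
  · have hr : (⟨0 * (z : ℂ).re, 1 * (z : ℂ).im⟩ : ℂ) = ((z : ℂ).im : ℂ) * Complex.I := by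
      apply Complex.ext <;> simp
    have h0 : ((z : ℂ).im : ℂ) ≠ 0 := by
      intro h0
      rw [hr, h0, zero_mul] at h
      exact h rfl
    rw [axisPoints, Set.mem_ofPred_eq, coe_scale h, hr, norm_mul, Complex.norm_I, mul_one,
      Complex.norm_real, Real.norm_eq_abs, mul_div_right_comm]
    rcases abs_choice (z : ℂ).im with h1 | h1 <;> simp [h1, div_neg, div_self h0]

end Circle

namespace Torus

variable {n : ℕ}

/-- An open neighbourhood of the union of the open cells of the standard cubical structure on
`(S¹)ⁿ`, with vertices `±1` in each factor, whose set of free directions is `S`. -/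
def cell (S : Finset (Fin n)) : Set (Torus n) :=
  {z | (∀ i ∈ S, 0 < |(z i : ℂ).im|) ∧ (∀ i ∉ S, |(z i : ℂ).im| < 1) ∧
    ∀ i ∈ S, ∀ l ∉ S, |(z l : ℂ).im| < |(z i : ℂ).im|}

lemma isOpen_cell (S : Finset (Fin n)) : IsOpen (cell S) := by
  have hc : ∀ i, Continuous fun z : Torus n => |(z i : ℂ).im| := fun i =>
    (Complex.continuous_im.comp (continuous_subtype_val.comp (continuous_apply i))).abs
  simp only [cell, Set.ofPred_and, Set.ofPred_forall]
  refine IsOpen.inter ?_ (IsOpen.inter ?_ ?_)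
  · exact isOpen_iInter_of_finite fun i => isOpen_iInter_of_finite fun _ =>
      isOpen_lt continuous_const (hc i)
  · exact isOpen_iInter_of_finite fun i => isOpen_iInter_of_finite fun _ =>
      isOpen_lt (hc i) continuous_const
  · exact isOpen_iInter_of_finite fun i => isOpen_iInter_of_finite fun _ =>
      isOpen_iInter_of_finite fun l => isOpen_iInter_of_finite fun _ => isOpen_lt (hc l) (hc i)

lemma kleinInvolution_mem_cell {S : Finset (Fin n)} {z : Torus n} :
    kleinInvolution n z ∈ cell S ↔ z ∈ cell S := by
  have h : ∀ i, |(kleinInvolution n z i : ℂ).im| = |(z i : ℂ).im| := by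
    intro i
    rw [kleinInvolution_apply]
    split_ifs
    · simp
    · rw [Circle.coe_inv_eq_conj]
      simp
  simp only [cell, Set.mem_ofPred_eq, h]

lemma eq_of_mem_cell {S T : Finset (Fin n)} (hST : S.card = T.card) {z : Torus n}
    (hS : z ∈ cell S) (hT : z ∈ cell T) : S = T := by
  by_contra hne
  have h1 : ¬ S ⊆ T := fun h => hne (Finset.eq_of_subset_of_card_le h hST.ge)
  have h2 : ¬ T ⊆ S := fun h => hne (Finset.eq_of_subset_of_card_le h hST.le).symm
  obtain ⟨i, hiS, hiT⟩ := Finset.not_subset.1 h1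
  obtain ⟨l, hlT, hlS⟩ := Finset.not_subset.1 h2
  exact lt_asymm (hS.2.2 i hiS l hlS) (hT.2.2 l hlT i hiT)

lemma exists_mem_cell (z : Torus n) : ∃ S : Finset (Fin n), z ∈ cell S := by
  classical
  refine ⟨Finset.univ.filter fun i => 0 < |(z i : ℂ).im|, ?_, ?_, ?_⟩
  · intro i hi
    simpa using hi
  · intro i hi
    simp only [Finset.mem_filter, Finset.mem_univ, true_and] at hi
    linarith
  · intro i hi l hl
    simp only [Finset.mem_filter, Finset.mem_univ, true_and] at hi hl
    linarith

/-- The deformation of `cell S` to finitely many points. -/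
def squash (S : Finset (Fin n)) (t : ℝ) (z : Torus n) : Torus n := fun i =>
  if i ∈ S then Circle.scale (1 - t) 1 (z i) else Circle.scale 1 (1 - t) (z i)

lemma scale_left_ne_zero {S : Finset (Fin n)} {z : Torus n} (hz : z ∈ cell S) {i : Fin n}
    (hi : i ∈ S) (t : ℝ) : (⟨t * (z i : ℂ).re, 1 * (z i : ℂ).im⟩ : ℂ) ≠ 0 := by
  intro h
  have := congrArg Complex.im h
  have h2 := hz.1 i hi
  simp only [one_mul, Complex.zero_im] at this
  simp [this] at h2

lemma scale_right_ne_zero {S : Finset (Fin n)} {z : Torus n} (hz : z ∈ cell S) {i : Fin n}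
    (hi : i ∉ S) (t : ℝ) : (⟨1 * (z i : ℂ).re, t * (z i : ℂ).im⟩ : ℂ) ≠ 0 := by
  intro h
  have := congrArg Complex.re h
  have h2 := hz.2.1 i hi
  simp only [one_mul, Complex.zero_re] at this
  have h3 := Circle.normSq_coe (z i)
  rw [Complex.normSq_apply, this] at h3
  rw [abs_lt] at h2
  nlinarith

lemma squash_zero (S : Finset (Fin n)) (z : Torus n) : squash S 0 z = z := by
  funext i
  simp [squash, Circle.scale_one_one]

lemma squash_one_mem (S : Finset (Fin n)) (z : Torus n) :
    squash S 1 z ∈ Set.pi Set.univ fun _ => Circle.axisPoints := by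
  intro i _
  simp only [squash, sub_self]
  split_ifs
  · exact Circle.scale_zero_one_mem _
  · exact Circle.scale_one_zero_mem _

lemma squash_kleinInvolution {S : Finset (Fin n)} {z : Torus n} (hz : z ∈ cell S) (t : ℝ) :
    squash S t (kleinInvolution n z) = kleinInvolution n (squash S t z) := by
  funext i
  simp only [squash, kleinInvolution_apply]
  split_ifs with h1 h2 h2
  · exact Circle.scale_neg (scale_left_ne_zero hz h1 _)
  · exact Circle.scale_inv _ _ _
  · exact Circle.scale_neg (scale_right_ne_zero hz h1 _)
  · exact Circle.scale_inv _ _ _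

lemma continuousAt_squash {S : Finset (Fin n)} {z : Torus n} (hz : z ∈ cell S) (t : ℝ) :
    ContinuousAt (fun p : ℝ × Torus n => squash S p.1 p.2) (t, z) := by
  refine continuousAt_pi.2 fun i => ?_
  simp only [squash]
  split_ifs with h
  · exact Circle.continuousAt_scale (by fun_prop) (by fun_prop) (by fun_prop)
      (scale_left_ne_zero hz h _)
  · exact Circle.continuousAt_scale (by fun_prop) (by fun_prop) (by fun_prop)
      (scale_right_ne_zero hz h _)

end Torus

namespace Klein

variable {n : ℕ}

instance : PathConnectedSpace (Klein n) :=
  isQuotientMap_mk.surjective.pathConnectedSpace isQuotientMap_mk.continuous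

instance : T1Space (Klein n) where
  t1 x := by
    obtain ⟨z, rfl⟩ := isQuotientMap_mk.surjective x
    rw [← isQuotientMap_mk.isClosed_preimage]
    have : Klein.mk ⁻¹' {Klein.mk z} = {z, kleinInvolution n z} := by
      ext w
      simp [mk_eq_mk_iff]
    rw [this]
    exact (Set.toFinite _).isClosed

/-- The image in `Kₙ` of the neighbourhoods of the open `j`-cells. -/
def stratum (n j : ℕ) : Set (Klein n) :=
  {x | ∃ S : Finset (Fin n), S.card = j ∧ ∃ z ∈ Torus.cell S, Klein.mk z = x}

lemma mk_mem_stratum_iff {j : ℕ} {z : Torus n} :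
    Klein.mk z ∈ stratum n j ↔ ∃ S : Finset (Fin n), S.card = j ∧ z ∈ Torus.cell S := by
  refine exists_congr fun S => and_congr_right fun _ => ⟨?_, fun h => ⟨z, h, rfl⟩⟩
  rintro ⟨w, hw, hwz⟩
  rcases mk_eq_mk_iff.1 hwz with rfl | rfl
  · exact hw
  · exact Torus.kleinInvolution_mem_cell.1 hw

lemma isOpen_stratum (n j : ℕ) : IsOpen (stratum n j) := by
  rw [← isQuotientMap_mk.isOpen_preimage]
  have : Klein.mk ⁻¹' stratum n j =
      ⋃ (S : Finset (Fin n)) (_ : S.card = j), Torus.cell S := by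
    ext z
    simp [mk_mem_stratum_iff]
  rw [this]
  exact isOpen_biUnion fun S _ => Torus.isOpen_cell S

theorem contractibleIn_stratum (hn : 0 < n) (j : ℕ) : ContractibleIn (stratum n j) := by
  choose S hS z hz hzx using fun x : stratum n j => x.2
  let H : unitInterval × stratum n j → Klein n := fun p =>
    Klein.mk (Torus.squash (S p.2) p.1 (z p.2))
  have hH : ∀ (t : unitInterval) (x : stratum n j) (T : Finset (Fin n)) (w : Torus n),
      T.card = j → w ∈ Torus.cell T → Klein.mk w = x →
      H (t, x) = Klein.mk (Torus.squash T t w) := by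
    intro t x T w hT hw hwx
    have hwz := mk_eq_mk_iff.1 (hwx.trans (hzx x).symm)
    have hwS : w ∈ Torus.cell (S x) := by
      rcases hwz with h | h
      · exact h ▸ hz x
      · exact h ▸ Torus.kleinInvolution_mem_cell.2 (hz x)
    obtain rfl := Torus.eq_of_mem_cell (hT.trans (hS x).symm) hw hwS
    rcases hwz with h | h
    · rw [h]
    · rw [h, Torus.squash_kleinInvolution (hz x), mk_kleinInvolution]
  let q : (Klein.mk ⁻¹' stratum n j : Set (Torus n)) → stratum n j :=
    (stratum n j).restrictPreimage Klein.mk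
  have hq : IsOpenQuotientMap q :=
    ⟨isQuotientMap_mk.surjective.restrictPreimage _,
      isQuotientMap_mk.continuous.restrictPreimage,
      (isOpenQuotientMap_mk hn).isOpenMap.restrictPreimage _⟩
  have hHc : Continuous H := by
    rw [((IsOpenQuotientMap.id (X := unitInterval)).prodMap hq).isQuotientMap.continuous_iff,
      continuous_iff_continuousAt]
    rintro ⟨t, w, hw⟩
    obtain ⟨T, hT, hwT⟩ := mk_mem_stratum_iff.1 hw
    have hι : Continuous fun p : unitInterval × (Klein.mk ⁻¹' stratum n j : Set (Torus n)) =>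
        ((p.1 : ℝ), (p.2 : Torus n)) := by fun_prop
    have h1 : ContinuousAt (fun p : unitInterval × (Klein.mk ⁻¹' stratum n j : Set (Torus n)) =>
        Klein.mk (Torus.squash T p.1 p.2)) (t, ⟨w, hw⟩) :=
      isQuotientMap_mk.continuous.continuousAt.comp
        (ContinuousAt.comp (g := fun p : ℝ × Torus n => Torus.squash T p.1 p.2)
          (f := fun p : unitInterval × (Klein.mk ⁻¹' stratum n j : Set (Torus n)) =>
            ((p.1 : ℝ), (p.2 : Torus n))) (x := (t, ⟨w, hw⟩))
          (Torus.continuousAt_squash hwT t) hι.continuousAt)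
    refine h1.congr ?_
    have h2 : ∀ᶠ p : unitInterval × (Klein.mk ⁻¹' stratum n j : Set (Torus n)) in
        nhds (t, ⟨w, hw⟩), (p.2 : Torus n) ∈ Torus.cell T :=
      (continuous_subtype_val.comp continuous_snd).continuousAt.eventually
        ((Torus.isOpen_cell T).mem_nhds hwT)
    filter_upwards [h2] with p hp
    exact (hH p.1 (q p.2) T p.2 hT hp rfl).symm
  refine .of_locallyConstant H hHc (fun x => ?_) ?_
  · simp only [H]
    rw [show ((0 : unitInterval) : ℝ) = 0 from rfl, Torus.squash_zero, hzx]
  · refine IsLocallyConstant.of_continuous_of_finite_range (by fun_prop)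
      ((Set.Finite.pi' fun _ : Fin n => Circle.finite_axisPoints).image Klein.mk) fun x => ?_
    exact ⟨_, fun i => Torus.squash_one_mem _ _ i trivial, rfl⟩

end Klein

/-- For `n ≥ 2` the reduced Lusternik–Schnirelmann category of `Kₙ`
equals `n`: it can be covered by `n+1` open subsets, each contractible in `Kₙ`, but not
by `n` such subsets. -/
theorem klein_LS_category (n : ℕ) (hn : 2 ≤ n) :
    (∃ U : Fin (n + 1) → Set (Klein n),
      (∀ i, IsOpen (U i) ∧ ContractibleIn (U i)) ∧ (⋃ i, U i) = Set.univ) ∧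
    ¬ ∃ U : Fin n → Set (Klein n),
      (∀ i, IsOpen (U i) ∧ ContractibleIn (U i)) ∧ (⋃ i, U i) = Set.univ := by
  refine ⟨⟨fun j => Klein.stratum n j, fun j => ⟨Klein.isOpen_stratum n j,
    Klein.contractibleIn_stratum (by omega) j⟩, ?_⟩, ?_⟩
  · refine Set.eq_univ_of_forall fun x => ?_
    obtain ⟨z, rfl⟩ := Klein.isQuotientMap_mk.surjective x
    obtain ⟨S, hS⟩ := Torus.exists_mem_cell z
    exact Set.mem_iUnion.2 ⟨⟨S.card, Nat.lt_succ_of_le (card_finset_fin_le S)⟩,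
      Klein.mk_mem_stratum_iff.2 ⟨S, rfl, hS⟩⟩
  · rintro ⟨U, hU, hcov⟩
    choose f hf hexp using fun k => (hU k).2.exists_log k
    refine Torus.no_log_cover n (fun k => Klein.mk ⁻¹' U k)
      (fun k => (hU k).1.preimage Klein.isQuotientMap_mk.continuous) ?_ f hf hexp
    rw [← Set.preimage_iUnion, hcov, Set.preimage_univ]
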